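/- Let G = (V, E) be a finite simple undirected graph with |V| = n and |E| = m, and let E' ⊆ E with |E'| = k. Then |AO_G(E')| · |Aut(G − E')| · C(C(n,2), m − k) · C(C(n,2) − (m − k), k) = |AO_{G−E'}(E')| · |Aut(G)| · C(m, k) · C(C(n,2), m), where C(·,·) denotes the binomial coefficient. -/

import Mathlib

/-- The set of automorphisms of a simple graph `G`: permutations `σ` of the
vertex set with `(a,b) ∈ E ↔ (σ a, σ b) ∈ E`. -/
def autSet {V : Type*} (G : SimpleGraph V) : Set (Equiv.Perm V) :=
  {σ | ∀ a b : V, G.Adj a b ↔ G.Adj (σ a) (σ b)}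

/-- The image of a set of unordered pairs under a permutation of the vertices. -/
def pairSetMap {V : Type*} (σ : Equiv.Perm V) (S : Set (Sym2 V)) : Set (Sym2 V) :=
  (Sym2.map σ) '' S

/-- The automorphism orbit of a set `S` of unordered vertex pairs in `G`:
`AO_G(S) = { σ(S) : σ ∈ Aut(G) }`. -/
def edgeSetOrbit {V : Type*} (G : SimpleGraph V) (S : Set (Sym2 V)) : Set (Set (Sym2 V)) :=
  {T | ∃ σ ∈ autSet G, pairSetMap σ S = T}

/-- The automorphism orbit of a vertex `v` in `G`: `AO_G(v) = { σ v : σ ∈ Aut(G) }`. -/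
def vertexOrbit {V : Type*} (G : SimpleGraph V) (v : V) : Set V :=
  {u | ∃ σ ∈ autSet G, σ v = u}

/-- `F` is an edge set on `V` forming a graph isomorphic to `G` (via a bijection of
the common vertex set carrying the edge set of `G` exactly onto `F`). -/
def isIsoEdgeSet {V : Type*} (G : SimpleGraph V) (F : Set (Sym2 V)) : Prop :=
  ∃ σ : Equiv.Perm V, pairSetMap σ G.edgeSet = F

theorem mem_autSet_iff {V : Type*} {G : SimpleGraph V} {σ : Equiv.Perm V} :
    σ ∈ autSet G ↔ pairSetMap σ G.edgeSet = G.edgeSet := by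
  have himg : pairSetMap σ G.edgeSet = Sym2.map σ.symm ⁻¹' G.edgeSet :=
    congrFun (Set.image_eq_preimage_of_inverse
      (fun e : Sym2 V => by simp [Sym2.map_map]) (fun e => by simp [Sym2.map_map])) _
  rw [himg, Set.ext_iff, Sym2.forall]
  simp only [autSet, Set.mem_ofPred_eq, Set.mem_preimage, Sym2.map_mk, SimpleGraph.mem_edgeSet]
  constructor
  · intro h a b
    simpa using h (σ.symm a) (σ.symm b)
  · intro h a b
    simpa using h (σ a) (σ b)

theorem mem_autSet_deleteEdges_iff {V : Type*} {G : SimpleGraph V} {S : Set (Sym2 V)}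
    (hS : S ⊆ G.edgeSet) {σ : Equiv.Perm V} (hσ : pairSetMap σ S = S) :
    σ ∈ autSet (G.deleteEdges S) ↔ σ ∈ autSet G := by
  rw [mem_autSet_iff, mem_autSet_iff, SimpleGraph.edgeSet_deleteEdges]
  have hinj : Function.Injective (Sym2.map σ) := Sym2.map.injective σ.injective
  unfold pairSetMap at *
  constructor
  · intro h
    rw [← Set.sdiff_union_of_subset hS, Set.image_union, h, hσ]
  · intro h
    rw [Set.image_sdiff hinj, h, hσ]

/-- The permutations of `V` act on the sets of unordered pairs of vertices. -/
@[reducible]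
def pairSetMulAction (V : Type*) : MulAction (Equiv.Perm V) (Set (Sym2 V)) where
  smul := pairSetMap
  one_smul S := by
    change Sym2.map id '' S = S
    simp
  mul_smul σ τ S := by
    change Sym2.map (σ ∘ τ) '' S = Sym2.map σ '' (Sym2.map τ '' S)
    rw [Sym2.map_comp, Set.image_comp]

/-- The automorphisms of `G` as a subgroup of the permutations of its vertices. -/
def autSubgroup {V : Type*} (G : SimpleGraph V) : Subgroup (Equiv.Perm V) where
  carrier := autSet G
  one_mem' _ _ := Iff.rfl
  mul_mem' hσ hτ a b := (hτ a b).trans (hσ _ _)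
  inv_mem' {σ} hσ a b := by simpa using (hσ (σ⁻¹ a) (σ⁻¹ b)).symm

theorem ncard_edgeSetOrbit_mul_ncard_stabilizer {V : Type*}
    (G : SimpleGraph V) (S : Set (Sym2 V)) :
    (edgeSetOrbit G S).ncard * {σ | σ ∈ autSet G ∧ pairSetMap σ S = S}.ncard =
      (autSet G).ncard := by
  let _ := pairSetMulAction V
  have horbit : edgeSetOrbit G S = MulAction.orbit (autSubgroup G) S := by
    ext T
    exact ⟨fun ⟨σ, hσ, h⟩ => ⟨⟨σ, hσ⟩, h⟩, fun ⟨σ, h⟩ => ⟨σ.1, σ.2, h⟩⟩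
  have hstab : {σ | σ ∈ autSet G ∧ pairSetMap σ S = S} =
      Subtype.val '' (MulAction.stabilizer (autSubgroup G) S : Set (autSubgroup G)) := by
    ext σ
    constructor
    · rintro ⟨hσ, h⟩
      exact ⟨⟨σ, hσ⟩, h, rfl⟩
    · rintro ⟨τ, h, rfl⟩
      exact ⟨τ.2, h⟩
  rw [hstab, Set.ncard_image_of_injective _ Subtype.val_injective, horbit,
    ← MulAction.index_stabilizer, mul_comm]
  exact Subgroup.card_mul_index (MulAction.stabilizer (autSubgroup G) S)

theorem ncard_edgeSetOrbit_mul_ncard_autSet_deleteEdges {V : Type*} [Finite V]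
    {G : SimpleGraph V} {S : Set (Sym2 V)} (hS : S ⊆ G.edgeSet) :
    (edgeSetOrbit G S).ncard * (autSet (G.deleteEdges S)).ncard =
      (edgeSetOrbit (G.deleteEdges S) S).ncard * (autSet G).ncard := by
  have hstab : {σ | σ ∈ autSet (G.deleteEdges S) ∧ pairSetMap σ S = S} =
      {σ | σ ∈ autSet G ∧ pairSetMap σ S = S} := by
    ext σ
    exact and_congr_left (mem_autSet_deleteEdges_iff hS)
  rw [← ncard_edgeSetOrbit_mul_ncard_stabilizer G S,
    ← ncard_edgeSetOrbit_mul_ncard_stabilizer (G.deleteEdges S) S, hstab]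
  ring

theorem Nat.choose_sub_mul_choose (N : ℕ) {m k : ℕ} (hkm : k ≤ m) :
    N.choose (m - k) * (N - (m - k)).choose k = m.choose k * N.choose m := by
  rw [mul_comm (m.choose k), ← Nat.choose_symm hkm]
  have h := Nat.choose_mul (n := N) (Nat.sub_le m k)
  rw [h, Nat.sub_sub_self hkm]

/-- Let `G = (V, E)` be a finite simple graph with `|V| = n`, `|E| = m`, and
`E' ⊆ E` with `|E'| = k`. Then
`|AO_G(E')| · |Aut(G − E')| · C(C(n,2), m − k) · C(C(n,2) − (m − k), k)
  = |AO_{G−E'}(E')| · |Aut(G)| · C(m, k) · C(C(n,2), m)`. -/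
theorem orbit_aut_binomial_identity {V : Type*} [Fintype V]
    (G : SimpleGraph V) (E' : Set (Sym2 V)) (hsub : E' ⊆ G.edgeSet)
    (n m k : ℕ) (hn : n = Fintype.card V) (hm : m = G.edgeSet.ncard) (hk : k = E'.ncard) :
    (edgeSetOrbit G E').ncard * (autSet (G.deleteEdges E')).ncard *
        Nat.choose (Nat.choose n 2) (m - k) * Nat.choose (Nat.choose n 2 - (m - k)) k =
      (edgeSetOrbit (G.deleteEdges E') E').ncard * (autSet G).ncard *
        Nat.choose m k * Nat.choose (Nat.choose n 2) m := by
  have hkm : k ≤ m := by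
    rw [hk, hm]
    exact Set.ncard_le_ncard hsub (Set.toFinite _)
  rw [mul_assoc, Nat.choose_sub_mul_choose _ hkm,
    ncard_edgeSetOrbit_mul_ncard_autSet_deleteEdges hsub, mul_assoc _ (m.choose k)]
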